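/- In R = ℂ[x,y,u,v], let a ∈ ℂ[u,v] be homogeneous of degree 2 and β ∈ ℂ[u,v] homogeneous of degree 1, and suppose that a and β·u have no common zero in ℂ² ∖ {0}. Let I = (x², x·y, u·y², a·x + β·u·y). Then there exists a natural number N such that for all t ≥ N the Hilbert function of R/I at t equals 3t + 2. (This is the Hilbert polynomial of the degree-3 curve Y which is the union of a double line on a smooth cubic surface and a line meeting it.) -/

import Mathlib

open MvPolynomial

/-- The Hilbert function of `R ⧸ I` at `t`, for a homogeneous ideal `I` of
`R = ℂ[x,y,u,v]`: `dim_ℂ R_t − dim_ℂ (I ∩ R_t)`. -/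
noncomputable def hilbertFn (I : Ideal (MvPolynomial (Fin 4) ℂ)) (t : ℕ) : ℤ :=
  (Module.finrank ℂ (MvPolynomial.homogeneousSubmodule (Fin 4) ℂ t) : ℤ) -
    (Module.finrank ℂ
      ↥(Submodule.restrictScalars ℂ I ⊓ MvPolynomial.homogeneousSubmodule (Fin 4) ℂ t) : ℤ)

/-- Variables: `x = X 0`, `y = X 1`, `u = X 2`, `v = X 3`; `ℂ[u,v] ⊆ ℂ[x,y,u,v]`;
in `ℂ[u,v] = MvPolynomial (Fin 2) ℂ` the variable `u` is `X 0`. -/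
noncomputable def embUV : MvPolynomial (Fin 2) ℂ →ₐ[ℂ] MvPolynomial (Fin 4) ℂ :=
  MvPolynomial.rename (fun i : Fin 2 => (i.succ.succ : Fin 4))

theorem MvPolynomial.finrank_restrictSupport {σ K : Type*} [Field K] (s : Set (σ →₀ ℕ)) :
    Module.finrank K (restrictSupport K s) = s.ncard :=
  Module.finrank_eq_nat_card_basis (basisRestrictSupport K s)

theorem MvPolynomial.homogeneousSubmodule_eq_restrictSupport (σ K : Type*) [Field K] (n : ℕ) :
    homogeneousSubmodule σ K n = restrictSupport K {d | d.degree = n} :=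
  homogeneousSubmodule_eq_finsupp_supported σ K n

theorem finite_setOf_degree_eq (σ : Type*) [Finite σ] (n : ℕ) :
    {d : σ →₀ ℕ | d.degree = n}.Finite :=
  (Finsupp.finite_of_degree_le n).subset fun _ hd => le_of_eq hd

instance (σ K : Type*) [Finite σ] [Field K] (n : ℕ) :
    FiniteDimensional K (homogeneousSubmodule σ K n) :=
  Module.Finite.iff_fg.mpr (homogeneousSubmodule_fg σ K n)

theorem MvPolynomial.finrank_homogeneousSubmodule_fin_two (K : Type*) [Field K] (n : ℕ) :
    Module.finrank K (homogeneousSubmodule (Fin 2) K n) = n + 1 := by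
  rw [homogeneousSubmodule_eq_restrictSupport, finrank_restrictSupport,
    ← Set.ncard_coe_finset (Finset.range (n + 1)) |>.trans (Finset.card_range _)]
  refine Set.ncard_congr (fun d _ => d 0) ?_ ?_ ?_
  · intro d hd
    simp only [Set.mem_ofPred_eq, Finsupp.degree_eq_sum, Fin.sum_univ_two] at hd
    simp only [Finset.coe_range, Set.mem_Iio]
    omega
  · intro d e hd he h
    simp only [Set.mem_ofPred_eq, Finsupp.degree_eq_sum, Fin.sum_univ_two] at hd he
    ext i
    fin_cases i <;> simp only [Fin.zero_eta, Fin.mk_one, Fin.isValue] <;> omega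
  · intro i hi
    simp only [Finset.coe_range, Set.mem_Iio] at hi
    refine ⟨Finsupp.equivFunOnFinite.symm ![i, n - i], ?_, by simp⟩
    simp only [Set.mem_ofPred_eq, Finsupp.degree_eq_sum, Fin.sum_univ_two]
    simp
    omega

/-- The exponents of the monomials in the ideal `(x², x·y, u·y²)`. -/
def multipleExponents : Set (Fin 4 →₀ ℕ) :=
  {d | 2 ≤ d 0 ∨ (1 ≤ d 0 ∧ 1 ≤ d 1) ∨ (1 ≤ d 2 ∧ 2 ≤ d 1)}

theorem span_monomials_eq_restrictSupport (K : Type*) [Field K] :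
    Submodule.restrictScalars K
      (Ideal.span {X 0 ^ 2, X 0 * X 1, X 2 * X 1 ^ 2} : Ideal (MvPolynomial (Fin 4) K)) =
      restrictSupport K multipleExponents := by
  have himage : ({X 0 ^ 2, X 0 * X 1, X 2 * X 1 ^ 2} : Set (MvPolynomial (Fin 4) K)) =
      (fun s => monomial s (1 : K)) '' {Finsupp.single 0 2,
        Finsupp.single 0 1 + Finsupp.single 1 1, Finsupp.single 2 1 + Finsupp.single 1 2} := by
    simp only [X_pow_eq_monomial]
    simp [Set.image_insert_eq, X]
  ext p
  rw [himage, Submodule.restrictScalars_mem, mem_ideal_span_monomial_image,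
    mem_restrictSupport_iff]
  refine forall₂_congr fun d _ => ?_
  simp [multipleExponents, Finsupp.le_def, Fin.forall_fin_succ]
  tauto

theorem ncard_degree_eq_diff_multipleExponents (t : ℕ) (ht : 1 ≤ t) :
    ({d : Fin 4 →₀ ℕ | d.degree = t} \ multipleExponents).ncard = 4 * t := by
  rw [← Set.ncard_coe_finset (Finset.range (4 * t)) |>.trans (Finset.card_range _)]
  symm
  refine Set.ncard_congr (fun i _ => Finsupp.equivFunOnFinite.symm
    (if i < t + 1 then ![0, 0, i, t - i]
    else if i < 2 * t + 1 then ![1, 0, i - (t + 1), t - 1 - (i - (t + 1))]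
    else if i < 3 * t + 1 then ![0, 1, i - (2 * t + 1), t - 1 - (i - (2 * t + 1))]
    else ![0, i - (3 * t + 1) + 2, 0, t - 2 - (i - (3 * t + 1))])) ?_ ?_ ?_
  · intro i hi
    simp only [Finset.coe_range, Set.mem_Iio] at hi
    simp only [multipleExponents, Set.mem_sdiff, Set.mem_ofPred_eq, Finsupp.degree_eq_sum,
      Fin.sum_univ_four]
    split_ifs <;> simp <;> omega
  · intro i j hi hj h
    simp only [Finset.coe_range, Set.mem_Iio] at hi hj
    have h := Finsupp.equivFunOnFinite.symm.injective h
    have h0 := congrFun h 0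
    have h1 := congrFun h 1
    have h2 := congrFun h 2
    clear h
    split_ifs at h0 h1 h2 <;> simp at h0 h1 h2 <;> omega
  · intro d hd
    simp only [multipleExponents, Set.mem_sdiff, Set.mem_ofPred_eq, Finsupp.degree_eq_sum,
      Fin.sum_univ_four] at hd
    obtain ⟨hsum, hd⟩ := hd
    refine ⟨if d 0 = 1 then d 2 + (t + 1) else if d 1 = 0 then d 2 else
      if d 1 = 1 then d 2 + (2 * t + 1) else d 1 - 2 + (3 * t + 1), ?_, ?_⟩
    · simp only [Finset.coe_range, Set.mem_Iio]
      split_ifs <;> omega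
    · ext k
      simp only [Finsupp.equivFunOnFinite_symm_apply_apply]
      split_ifs <;> first | omega | (fin_cases k <;> simp <;> omega)

theorem finrank_monomial_part (K : Type*) [Field K] (t : ℕ) (ht : 1 ≤ t) :
    4 * t + Module.finrank K ↥(restrictSupport K multipleExponents ⊓
      homogeneousSubmodule (Fin 4) K t) =
    Module.finrank K (homogeneousSubmodule (Fin 4) K t) := by
  have hinf : restrictSupport K multipleExponents ⊓ homogeneousSubmodule (Fin 4) K t =
      restrictSupport K ({d | d.degree = t} ∩ multipleExponents) := by
    ext p
    rw [homogeneousSubmodule_eq_restrictSupport, Submodule.mem_inf]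
    simp only [mem_restrictSupport_iff, Set.subset_inter_iff]
    exact and_comm
  rw [hinf, homogeneousSubmodule_eq_restrictSupport, finrank_restrictSupport,
    finrank_restrictSupport, ← ncard_degree_eq_diff_multipleExponents t ht, add_comm]
  exact Set.ncard_inter_add_ncard_sdiff_eq_ncard _ _ (finite_setOf_degree_eq _ _)

/-- Substitution `x ↦ ε`, `y ↦ 0` into the dual numbers over `ℂ[u,v]`. -/
noncomputable def toDualNumber :
    MvPolynomial (Fin 4) ℂ →ₐ[ℂ] DualNumber (MvPolynomial (Fin 2) ℂ) :=
  aeval ![DualNumber.eps, 0, TrivSqZeroExt.inl (X 0), TrivSqZeroExt.inl (X 1)]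

theorem toDualNumber_embUV (s : MvPolynomial (Fin 2) ℂ) :
    toDualNumber (embUV s) = TrivSqZeroExt.inl s := by
  have h : toDualNumber.comp embUV =
      TrivSqZeroExt.inlAlgHom ℂ (MvPolynomial (Fin 2) ℂ) (MvPolynomial (Fin 2) ℂ) := by
    ext i : 1
    fin_cases i <;> simp [toDualNumber, embUV]
  exact DFunLike.congr_fun h s

theorem toDualNumber_eq_zero {p : MvPolynomial (Fin 4) ℂ}
    (hp : p ∈ (Ideal.span {X 0 ^ 2, X 0 * X 1, X 2 * X 1 ^ 2} : Ideal (MvPolynomial (Fin 4) ℂ))) :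
    toDualNumber p = 0 := by
  have hle : Ideal.span {X 0 ^ 2, X 0 * X 1, X 2 * X 1 ^ 2} ≤ RingHom.ker toDualNumber := by
    rw [Ideal.span_le]
    rintro q (rfl | rfl | rfl) <;> simp [toDualNumber, RingHom.mem_ker]
  exact hle hp

/-- Multiplication of polynomials in `u, v` by a fixed polynomial in `x, y, u, v`. -/
noncomputable def embUVMul (f : MvPolynomial (Fin 4) ℂ) :
    MvPolynomial (Fin 2) ℂ →ₗ[ℂ] MvPolynomial (Fin 4) ℂ :=
  LinearMap.mulRight ℂ f ∘ₗ embUV.toLinearMap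

@[simp] theorem embUVMul_apply (f : MvPolynomial (Fin 4) ℂ) (s : MvPolynomial (Fin 2) ℂ) :
    embUVMul f s = embUV s * f := rfl

theorem eq_zero_of_embUVMul_mem {a b s : MvPolynomial (Fin 2) ℂ} (ha : a ≠ 0)
    (h : embUVMul (embUV a * X 0 + embUV b * X 1) s ∈
      (Ideal.span {X 0 ^ 2, X 0 * X 1, X 2 * X 1 ^ 2} : Ideal (MvPolynomial (Fin 4) ℂ))) :
    s = 0 := by
  have h0 := congrArg TrivSqZeroExt.snd (toDualNumber_eq_zero h)
  have hx : toDualNumber (X 0) = DualNumber.eps := by simp [toDualNumber]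
  have hy : toDualNumber (X 1) = 0 := by simp [toDualNumber]
  simp only [embUVMul_apply, map_mul, map_add, toDualNumber_embUV, hx, hy] at h0
  simpa [ha] using h0

/-- If `x` and `y` multiply `f` into `M`, then modulo `M` every multiple of `f` is a multiple
by a polynomial in `u, v`. -/
theorem mul_mem_sup_range_embUVMul {M : Ideal (MvPolynomial (Fin 4) ℂ)}
    {f : MvPolynomial (Fin 4) ℂ} (hx : X 0 * f ∈ M) (hy : X 1 * f ∈ M)
    (r : MvPolynomial (Fin 4) ℂ) :
    r * f ∈ M.restrictScalars ℂ ⊔ (embUVMul f).range := by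
  induction r using MvPolynomial.induction_on' with
  | add p q hp hq => rw [add_mul]; exact add_mem hp hq
  | monomial d c =>
    by_cases h0 : d 0 = 0
    · by_cases h1 : d 1 = 0
      · refine Submodule.mem_sup_right
          ⟨monomial (Finsupp.single 0 (d 2) + Finsupp.single 1 (d 3)) c, ?_⟩
        rw [embUVMul_apply]
        congr 1
        rw [embUV, rename_monomial, Finsupp.mapDomain_add, Finsupp.mapDomain_single,
          Finsupp.mapDomain_single]
        congr 2
        ext k
        fin_cases k <;> simp [h0, h1]
      · refine Submodule.mem_sup_left (M.mem_of_dvd ?_ hy)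
        exact mul_dvd_mul_right (X_dvd_monomial.mpr (Or.inr h1)) f
    · refine Submodule.mem_sup_left (M.mem_of_dvd ?_ hx)
      exact mul_dvd_mul_right (X_dvd_monomial.mpr (Or.inr h0)) f

theorem homogeneousComponent_embUVMul {f : MvPolynomial (Fin 4) ℂ} {n : ℕ}
    (hf : f.IsHomogeneous n) (m : ℕ) (s : MvPolynomial (Fin 2) ℂ) :
    homogeneousComponent (m + n) (embUVMul f s) = embUVMul f (homogeneousComponent m s) := by
  have hhom (i : ℕ) : (embUVMul f (homogeneousComponent i s)).IsHomogeneous (i + n) :=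
    (homogeneousComponent_isHomogeneous i s).rename_isHomogeneous.mul hf
  conv_lhs => rw [← sum_homogeneousComponent s, map_sum, map_sum]
  simp only [fun i => homogeneousComponent_of_mem (m := m + n) (hhom i), add_left_inj]
  rw [Finset.sum_ite_eq]
  split_ifs with hm
  · rfl
  · rw [homogeneousComponent_eq_zero m s (by simpa using hm), map_zero]

theorem homogeneousComponent_mem_restrictSupport {σ K : Type*} [Field K] {s : Set (σ →₀ ℕ)}
    {p : MvPolynomial σ K} (hp : p ∈ restrictSupport K s) (n : ℕ) :
    homogeneousComponent n p ∈ restrictSupport K s := by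
  classical
  rw [mem_restrictSupport_iff] at hp ⊢
  intro d hd
  apply hp
  simp only [Finset.mem_coe, mem_support_iff, coeff_homogeneousComponent] at hd ⊢
  exact fun h => hd (by simp [h])

theorem sup_range_inf_homogeneousSubmodule {f : MvPolynomial (Fin 4) ℂ} {n : ℕ}
    (hf : f.IsHomogeneous n) (s : Set (Fin 4 →₀ ℕ)) (m : ℕ) :
    (restrictSupport ℂ s ⊔ (embUVMul f).range) ⊓ homogeneousSubmodule (Fin 4) ℂ (m + n) =
      (restrictSupport ℂ s ⊓ homogeneousSubmodule (Fin 4) ℂ (m + n)) ⊔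
        (homogeneousSubmodule (Fin 2) ℂ m).map (embUVMul f) := by
  apply le_antisymm
  · rintro p ⟨hp, hpt⟩
    obtain ⟨q, hq, _, ⟨r, rfl⟩, rfl⟩ := Submodule.mem_sup.mp hp
    have h := homogeneousComponent_of_mem (m := m + n) hpt
    rw [if_pos rfl, map_add, homogeneousComponent_embUVMul hf] at h
    rw [← h]
    exact Submodule.add_mem_sup
      ⟨homogeneousComponent_mem_restrictSupport hq _, homogeneousComponent_isHomogeneous _ _⟩
      ⟨_, homogeneousComponent_isHomogeneous _ _, rfl⟩
  · refine sup_le (inf_le_inf_right _ le_sup_left) ?_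
    rintro _ ⟨r, hr, rfl⟩
    exact ⟨Submodule.mem_sup_right ⟨r, rfl⟩,
      IsHomogeneous.mul (IsHomogeneous.rename_isHomogeneous hr) hf⟩

/-- The degree-3 curve `Y`, union of a double line on a smooth cubic surface and a
line meeting it, with ideal `I = (x², x·y, u·y², a·x + β·u·y)`, has Hilbert
polynomial `3t + 2`. -/
theorem double_line_union_meeting_line_hilbert_polynomial
    (a β : MvPolynomial (Fin 2) ℂ)
    (ha : a.IsHomogeneous 2) (hβ : β.IsHomogeneous 1)
    (haβ : ∀ p : Fin 2 → ℂ, p ≠ 0 → ¬(eval p a = 0 ∧ eval p β * p 0 = 0)) :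
    ∃ N : ℕ, ∀ t : ℕ, N ≤ t →
      hilbertFn (Ideal.span {X 0 ^ 2, X 0 * X 1, X 2 * X 1 ^ 2,
          embUV a * X 0 + embUV β * X 2 * X 1}) t
        = 3 * (t : ℤ) + 2 := by
  have ha0 : a ≠ 0 := by
    rintro rfl
    exact haβ ![0, 1] (fun h => by simpa using congrFun h 1) (by simp)
  have hu : embUV (X 0) = X 2 := by simp [embUV]
  have hf : embUV a * X 0 + embUV β * X 2 * X 1 = embUV a * X 0 + embUV (β * X 0) * X 1 := by
    rw [map_mul, hu]
  set f := embUV a * X 0 + embUV β * X 2 * X 1 with hfdef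
  have hfhom : f.IsHomogeneous 3 :=
    (ha.rename_isHomogeneous.mul (isHomogeneous_X ℂ 0)).add
      ((hβ.rename_isHomogeneous.mul (isHomogeneous_X ℂ 2)).mul (isHomogeneous_X ℂ 1))
  set M : Ideal (MvPolynomial (Fin 4) ℂ) :=
    Ideal.span {X 0 ^ 2, X 0 * X 1, X 2 * X 1 ^ 2} with hM
  have hxx : X 0 ^ 2 ∈ M := Ideal.subset_span (by simp)
  have hxy : X 0 * X 1 ∈ M := Ideal.subset_span (by simp)
  have huyy : X 2 * X 1 ^ 2 ∈ M := Ideal.subset_span (by simp)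
  have hxf : X 0 * f ∈ M := by
    have h := add_mem (M.mul_mem_left (embUV a) hxx) (M.mul_mem_left (embUV β * X 2) hxy)
    convert h using 1
    rw [hfdef]; ring
  have hyf : X 1 * f ∈ M := by
    have h := add_mem (M.mul_mem_left (embUV a) hxy) (M.mul_mem_left (embUV β) huyy)
    convert h using 1
    rw [hfdef]; ring
  have hI : Submodule.restrictScalars ℂ (Ideal.span {X 0 ^ 2, X 0 * X 1, X 2 * X 1 ^ 2, f}) =
      restrictSupport ℂ multipleExponents ⊔ (embUVMul f).range := by
    rw [← span_monomials_eq_restrictSupport, ← hM]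
    have hsup : Ideal.span {X 0 ^ 2, X 0 * X 1, X 2 * X 1 ^ 2, f} = M ⊔ Ideal.span {f} := by
      simp only [hM, Ideal.span_insert, sup_assoc]
    rw [hsup]
    apply le_antisymm
    · intro p hp
      obtain ⟨q, hq, r, hr, rfl⟩ :=
        Submodule.mem_sup.mp (Submodule.restrictScalars_mem ℂ _ _ |>.mp hp)
      obtain ⟨c, rfl⟩ := Ideal.mem_span_singleton'.mp hr
      exact add_mem (Submodule.mem_sup_left hq) (mul_mem_sup_range_embUVMul hxf hyf c)
    · refine sup_le (fun p hp => Submodule.mem_sup_left (S := M) hp) ?_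
      rintro _ ⟨s, rfl⟩
      exact Submodule.mem_sup_right (S := M) (Ideal.mem_span_singleton'.mpr ⟨_, rfl⟩)
  have hker : ∀ s, embUVMul f s ∈ M → s = 0 := fun s hs => by
    rw [hf] at hs
    exact eq_zero_of_embUVMul_mem ha0 hs
  have hinj : Function.Injective (embUVMul f) :=
    (injective_iff_map_eq_zero _).mpr fun s hs => hker s (hs ▸ M.zero_mem)
  refine ⟨3, fun t ht => ?_⟩
  obtain ⟨m, rfl⟩ := Nat.exists_eq_add_of_le' ht
  have hdisj : (restrictSupport ℂ multipleExponents ⊓ homogeneousSubmodule (Fin 4) ℂ (m + 3)) ⊓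
      (homogeneousSubmodule (Fin 2) ℂ m).map (embUVMul f) = ⊥ := by
    rw [eq_bot_iff]
    rintro _ ⟨⟨hp, -⟩, s, -, rfl⟩
    rw [SetLike.mem_coe, ← span_monomials_eq_restrictSupport] at hp
    rw [hker s hp, map_zero]
    exact zero_mem _
  have : FiniteDimensional ℂ ↥(restrictSupport ℂ multipleExponents ⊓
      homogeneousSubmodule (Fin 4) ℂ (m + 3)) := Submodule.finiteDimensional_inf_right _ _
  have hdim := Submodule.finrank_sup_add_finrank_inf_eq
    (restrictSupport ℂ multipleExponents ⊓ homogeneousSubmodule (Fin 4) ℂ (m + 3))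
    ((homogeneousSubmodule (Fin 2) ℂ m).map (embUVMul f))
  have hmap : Module.finrank ℂ ((homogeneousSubmodule (Fin 2) ℂ m).map (embUVMul f)) = m + 1 := by
    rw [← (Submodule.equivMapOfInjective _ hinj _).finrank_eq,
      finrank_homogeneousSubmodule_fin_two]
  rw [hdisj, finrank_bot, hmap] at hdim
  have hmon := finrank_monomial_part ℂ (m + 3) (by omega)
  rw [hilbertFn, hI, sup_range_inf_homogeneousSubmodule hfhom]
  push_cast
  omega
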